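/- Let G be a dynamic graph over a finite nonempty set V with a self-loop at every node in every round, with start rounds s_u and input values μ_u in a finite linearly ordered set 𝒱, and let x_u(t) and AGE_u(t) be defined by the AGE recursion. Then for every node u and every round t ≥ 1, x_u(t) = m_u(t). -/

import Mathlib

open scoped Classical

section DynamicGraphs

variable {V : Type*}

/-- The product digraph `G(t:t')`: edge `(u,v)` iff there is a path
`w_t = u, …, w_{t'+1} = v` with `(w_k, w_{k+1})` an edge of `G(k)` for `t ≤ k ≤ t'`.
For `t' < t` it is the digraph with exactly a self-loop at each node. -/
def DProd (G : ℕ → V → V → Prop) (t t' : ℕ) (u v : V) : Prop :=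
  if t' < t then u = v
  else ∃ w : ℕ → V, w t = u ∧ w (t' + 1) = v ∧ ∀ k, t ≤ k → k ≤ t' → G k (w k) (w (k + 1))

/-- The integral `Ḡ`: `(u,v)` is an edge of `Ḡ(t)` iff it is an edge of `G(t:t')`
for some `t' ≥ t`. -/
def Integral (G : ℕ → V → V → Prop) (t : ℕ) (u v : V) : Prop :=
  ∃ t', t ≤ t' ∧ DProd G t t' u v

/-- The limit superior of a dynamic graph: edges occurring at infinitely many rounds. -/
def LimSupG (H : ℕ → V → V → Prop) (u v : V) : Prop :=
  ∀ t : ℕ, ∃ t', t ≤ t' ∧ H t' u v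

/-- `u` is a central root of the digraph `H`: `(u,v)` is an edge for every `v`. -/
def IsCRoot (H : V → V → Prop) (u : V) : Prop := ∀ v, H u v

/-- `u` is a root of the digraph `H`: every node is reachable from `u` by a path. -/
def IsRoot (H : V → V → Prop) (u : V) : Prop := ∀ v, Relation.ReflTransGen H u v

/-- The kernel of a dynamic graph: `Ker(G) = ∩_{t ≥ 1} CRoots(Ḡ(t))`. -/
def Ker (G : ℕ → V → V → Prop) : Set V :=
  {u | ∀ t, 1 ≤ t → IsCRoot (Integral G t) u}

/-- `G` is rooted with delay `T`: for every `t ≥ 1` the digraph `G(t : t+T-1)` is rooted. -/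
def RootedWithDelay (G : ℕ → V → V → Prop) (T : ℕ) : Prop :=
  ∀ t, 1 ≤ t → ∃ u, IsRoot (fun a b => DProd G t (t + T - 1) a b) u

/-- The active graph `G^a` for start rounds `s`: `(u,v)` is an edge iff `u = v`, or
`(u,v)` is an edge of `G(t)` and both `u` and `v` are active in round `t`. -/
def Ga (G : ℕ → V → V → Prop) (s : V → ℕ) (t : ℕ) (u v : V) : Prop :=
  u = v ∨ (G t u v ∧ s u ≤ t ∧ s v ≤ t)

lemma dprod_refl (H : ℕ → V → V → Prop) (hH : ∀ t u, H t u u) (t t' : ℕ) (u : V) :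
    DProd H t t' u u := by
  unfold DProd
  split
  · rfl
  · exact ⟨fun _ => u, rfl, rfl, fun k _ _ => hH k u⟩

lemma ga_refl (G : ℕ → V → V → Prop) (s : V → ℕ) : ∀ (t : ℕ) (u : V), Ga G s t u u :=
  fun _ u => Or.inl rfl

end DynamicGraphs

section Values

variable {V 𝒱 : Type*} [Fintype V] [LinearOrder 𝒱]

/-- `m_u(t) = min{μ_v : v ∈ In^a_u(1:t)}`. -/
noncomputable def mVal (G : ℕ → V → V → Prop) (s : V → ℕ) (μ : V → 𝒱) (u : V) (t : ℕ) : 𝒱 :=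
  (Finset.univ.filter fun v => DProd (Ga G s) 1 t v u).inf'
    ⟨u, Finset.mem_filter.mpr ⟨Finset.mem_univ u, dprod_refl (Ga G s) (ga_refl G s) 1 t u⟩⟩ μ

/-- `m*_u = min{μ_v : v ∈ In^a_u(1:∞)}`. -/
noncomputable def mStar (G : ℕ → V → V → Prop) (s : V → ℕ) (μ : V → 𝒱) (u : V) : 𝒱 :=
  (Finset.univ.filter fun v => ∃ t', 1 ≤ t' ∧ DProd (Ga G s) 1 t' v u).inf'
    ⟨u, Finset.mem_filter.mpr ⟨Finset.mem_univ u,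
      ⟨1, le_refl 1, dprod_refl (Ga G s) (ga_refl G s) 1 1 u⟩⟩⟩ μ

/-- `m* = max{m*_u : u ∈ V}`. -/
noncomputable def mStarMax [Nonempty V] (G : ℕ → V → V → Prop) (s : V → ℕ) (μ : V → 𝒱) : 𝒱 :=
  Finset.univ.sup' Finset.univ_nonempty (mStar G s μ)

/-- The MinMax output `y_u(t) = max{ m_v(θ_u(t)) : v ∈ In^a_u(θ_u(t)+1 : t) }`. -/
noncomputable def yVal (G : ℕ → V → V → Prop) (s : V → ℕ) (μ : V → 𝒱) (θ : V → ℕ → ℕ)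
    (u : V) (t : ℕ) : 𝒱 :=
  (Finset.univ.filter fun v => DProd (Ga G s) (θ u t + 1) t v u).sup'
    ⟨u, Finset.mem_filter.mpr
      ⟨Finset.mem_univ u, dprod_refl (Ga G s) (ga_refl G s) (θ u t + 1) t u⟩⟩
    (fun v => mVal G s μ v (θ u t))

/-- The cut-offs are safe: `θ_u(t) → ∞` and `t - θ_u(t) → ∞`. -/
def SafeCutoffs (θ : V → ℕ → ℕ) : Prop :=
  ∀ u : V, Filter.Tendsto (fun t => θ u t) Filter.atTop Filter.atTop ∧
    Filter.Tendsto (fun t => t - θ u t) Filter.atTop Filter.atTop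

end Values

section Age

variable {V 𝒱 : Type*} [Fintype V] [Fintype 𝒱] [LinearOrder 𝒱]

/-- The AGE recursion, computing for each round `t` and node `u` the pair
`(x_u(t), AGE_u(t))`. -/
noncomputable def AgeX (G : ℕ → V → V → Prop) (s : V → ℕ) (μ : V → 𝒱) :
    ℕ → V → 𝒱 × (𝒱 → ℕ∞)
  | 0 => fun u => (μ u, fun ν => if ν = μ u then 0 else ⊤)
  | t + 1 => fun u =>
      if s u ≤ t + 1 then
        let A : 𝒱 → ℕ∞ := fun ν =>
          1 + (Finset.univ.filter fun v => Ga G s (t + 1) v u).inf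
            (fun v => (AgeX G s μ t v).2 ν)
        let x : 𝒱 :=
          if h : (Finset.univ.filter fun ν => A ν < ⊤).Nonempty then
            (Finset.univ.filter fun ν => A ν < ⊤).min' h
          else μ u
        (x, fun ν => if ν = x then 0 else A ν)
      else (μ u, fun ν => if ν = μ u then 0 else ⊤)

end Age

lemma dprod_zero {V : Type*} (H : ℕ → V → V → Prop) (u v : V) : DProd H 1 0 u v ↔ u = v := by
  simp [DProd]

lemma dprod_one_succ {V : Type*} (H : ℕ → V → V → Prop) (t : ℕ) (u v : V) :
    DProd H 1 (t + 1) u v ↔ ∃ w, DProd H 1 t u w ∧ H (t + 1) w v := by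
  have hlt : ¬ t + 1 < 1 := by omega
  constructor
  · intro h
    rw [DProd, if_neg hlt] at h
    obtain ⟨w, rfl, rfl, hw⟩ := h
    refine ⟨w (t + 1), ?_, hw (t + 1) (by omega) le_rfl⟩
    unfold DProd
    split_ifs with ht
    · obtain rfl : t = 0 := by omega
      rfl
    · exact ⟨w, rfl, rfl, fun k h1 h2 => hw k h1 (by omega)⟩
  · rintro ⟨x, hx, hxv⟩
    obtain ⟨w, hw1, hwt, hw⟩ : ∃ w : ℕ → V, w 1 = u ∧ w (t + 1) = x ∧
        ∀ k, 1 ≤ k → k ≤ t → H k (w k) (w (k + 1)) := by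
      unfold DProd at hx
      split_ifs at hx with ht
      · exact ⟨fun _ => u, rfl, hx, fun k h1 h2 => by omega⟩
      · exact hx
    rw [DProd, if_neg hlt]
    refine ⟨Function.update w (t + 2) v, ?_, ?_, fun k h1 h2 => ?_⟩
    · rw [Function.update_of_ne (by omega), hw1]
    · exact Function.update_self _ _ _
    · rw [Function.update_of_ne (by omega)]
      rcases h2.eq_or_lt with rfl | h2
      · rw [Function.update_self, hwt]
        exact hxv
      · rw [Function.update_of_ne (by omega)]
        exact hw k h1 (by omega)

section AgeRecursion

variable {V 𝒱 : Type*} [Fintype V] [Fintype 𝒱] [LinearOrder 𝒱]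

lemma ageX_of_lt (G : ℕ → V → V → Prop) {s : V → ℕ} (μ : V → 𝒱) {t : ℕ} {u : V} (h : t < s u) :
    AgeX G s μ t u = (μ u, fun ν => if ν = μ u then 0 else ⊤) := by
  cases t with
  | zero => rfl
  | succ t => exact if_neg (by omega)

/-- The age vector `A` computed in round `t + 1`, before the entry of the output is reset. -/
noncomputable def preAge (G : ℕ → V → V → Prop) (s : V → ℕ) (μ : V → 𝒱) (t : ℕ) (u : V)
    (ν : 𝒱) : ℕ∞ :=
  1 + (Finset.univ.filter fun v => Ga G s (t + 1) v u).inf (fun v => (AgeX G s μ t v).2 ν)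

lemma preAge_lt_top_iff (G : ℕ → V → V → Prop) (s : V → ℕ) (μ : V → 𝒱) (t : ℕ) (u : V) (ν : 𝒱) :
    preAge G s μ t u ν < ⊤ ↔ ∃ v, Ga G s (t + 1) v u ∧ (AgeX G s μ t v).2 ν < ⊤ := by
  simp [preAge, Finset.inf_lt_iff]

lemma ageX_succ_of_le (G : ℕ → V → V → Prop) {s : V → ℕ} (μ : V → 𝒱) {t : ℕ} {u : V}
    (hu : s u ≤ t + 1) (h : (Finset.univ.filter fun ν => preAge G s μ t u ν < ⊤).Nonempty) :
    AgeX G s μ (t + 1) u =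
      ((Finset.univ.filter fun ν => preAge G s μ t u ν < ⊤).min' h,
        fun ν => if ν = (Finset.univ.filter fun ν => preAge G s μ t u ν < ⊤).min' h then 0
          else preAge G s μ t u ν) := by
  unfold preAge at h ⊢
  simp only [AgeX, if_pos hu, dif_pos h]

/-- Finite entries of the age vector, and its output, in terms of the values heard of. -/
lemma ageX_spec (G : ℕ → V → V → Prop) (s : V → ℕ) (μ : V → 𝒱) (t : ℕ) (u : V) :
    (∀ ν, (AgeX G s μ t u).2 ν < ⊤ ↔ ∃ v, DProd (Ga G s) 1 t v u ∧ μ v = ν) ∧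
      IsLeast {ν | ∃ v, DProd (Ga G s) 1 t v u ∧ μ v = ν} (AgeX G s μ t u).1 := by
  induction t generalizing u with
  | zero =>
    simp only [dprod_zero, exists_eq_left, AgeX]
    refine ⟨fun ν => ?_, rfl, fun ν hν => le_of_eq hν⟩
    split_ifs with h <;> simp [h, eq_comm]
  | succ t ih =>
    by_cases hu : s u ≤ t + 1
    · have hA (ν : 𝒱) : preAge G s μ t u ν < ⊤ ↔ ∃ v, DProd (Ga G s) 1 (t + 1) v u ∧ μ v = ν := by
        simp only [preAge_lt_top_iff, (ih _).1, dprod_one_succ]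
        tauto
      have hne : (Finset.univ.filter fun ν => preAge G s μ t u ν < ⊤).Nonempty :=
        ⟨μ u, by simpa using (hA _).2 ⟨u, dprod_refl _ (ga_refl G s) _ _ _, rfl⟩⟩
      have hmin := Finset.isLeast_min' _ hne
      rw [ageX_succ_of_le G μ hu hne]
      refine ⟨fun ν => ?_, ?_⟩
      · dsimp only
        rw [← hA]
        split_ifs with h
        · subst h
          simpa using (Finset.mem_filter.1 hmin.1).2
        · rfl
      · simpa only [Finset.coe_filter, Finset.mem_univ, true_and, hA] using hmin
    · have hreach (v : V) : DProd (Ga G s) 1 (t + 1) v u ↔ DProd (Ga G s) 1 t v u := by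
        simp [dprod_one_succ, Ga, hu]
      simp only [hreach]
      rw [ageX_of_lt G μ (t := t + 1) (by omega), ← ageX_of_lt G (s := s) μ (t := t) (by omega)]
      exact ih u

end AgeRecursion

/-- in the AGE recursion, `x_u(t) = m_u(t)` for every node `u` and round
`t ≥ 1`. -/
theorem ageX_fst_eq_mVal {V 𝒱 : Type*} [Fintype V] [Nonempty V] [Fintype 𝒱]
    [LinearOrder 𝒱]
    (G : ℕ → V → V → Prop) (hloop : ∀ t u, G t u u)
    (s : V → ℕ) (hs : ∀ u, 1 ≤ s u) (μ : V → 𝒱) :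
    ∀ (u : V) (t : ℕ), 1 ≤ t → (AgeX G s μ t u).1 = mVal G s μ u t := by
  intro u t _
  refine (ageX_spec G s μ t u).2.unique ?_
  obtain ⟨v, hv, h⟩ := Finset.exists_mem_eq_inf' (s := Finset.univ.filter fun v =>
    DProd (Ga G s) 1 t v u) ⟨u, by simpa using dprod_refl _ (ga_refl G s) 1 t u⟩ μ
  refine ⟨⟨v, (Finset.mem_filter.1 hv).2, h.symm⟩, ?_⟩
  rintro _ ⟨w, hw, rfl⟩
  exact Finset.inf'_le _ (by simpa using hw)
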